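/- Let Ω ⊆ ℝ³ \ {0} be open, let γ > 1, c_V > 0, π∞, μ, κ, g₀ be real constants, ω ∈ ℝ³ a constant vector, and let p, T : ℝ × Ω → ℝ and u : ℝ × Ω → ℝ³ be twice continuously differentiable with p + π∞ > 0 and T > 0 everywhere. Define ρ = (p + π∞)/(c_V(γ−1)T), the viscous stress σ̂ = μ[∇u + (∇u)ᵀ − (2/3)(div u)·I], the gravity field g(x) = g₀ x/‖x‖, and the total energy E = p/(γ−1) + γπ∞/(γ−1) + (1/2)ρ‖u‖² + ρ g₀ ‖x‖. Assume on ℝ × Ω: the mass conservation equation ∂ₜρ + div(ρu) = 0, the non-conservative momentum equation ∂ₜu + (u·∇)u + (1/ρ)∇p − (1/ρ)div σ̂ + g + 2(ω × u) = 0, and the energy conservation equation ∂ₜE + div((E + p)u) − div(κ∇T + σ̂u) = 0. Then the non-conservative pressure equation ∂ₜp + u·∇p + γ(p + π∞)·div u − (γ−1)·div(κ∇T) − (γ−1)·(∇u : σ̂) = 0 holds on ℝ × Ω. -/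

import Mathlib

noncomputable section

/-- Spacetime: time `ℝ` times three-dimensional Euclidean space. -/
abbrev SpaceTime : Type := ℝ × EuclideanSpace ℝ (Fin 3)

/-- Time partial derivative `∂ₜ f` of a scalar field on spacetime. -/
def pdt (f : SpaceTime → ℝ) (q : SpaceTime) : ℝ :=
  fderiv ℝ f q (1, 0)

/-- Spatial partial derivative `∂ᵢ f` in the `i`-th coordinate direction. -/
def pd (i : Fin 3) (f : SpaceTime → ℝ) (q : SpaceTime) : ℝ :=
  fderiv ℝ f q (0, EuclideanSpace.single i 1)

/-- Spatial divergence `div v = Σᵢ ∂ᵢ vᵢ` of a vector field given componentwise. -/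
def sdiv (v : SpaceTime → Fin 3 → ℝ) (q : SpaceTime) : ℝ :=
  ∑ i, pd i (fun q => v q i) q

/-- Cross product of two vectors in `ℝ³`. -/
def cross (a b : Fin 3 → ℝ) : Fin 3 → ℝ :=
  ![a 1 * b 2 - a 2 * b 1, a 2 * b 0 - a 0 * b 2, a 0 * b 1 - a 1 * b 0]

/-- The viscous stress tensor `σ̂ = μ[∇u + (∇u)ᵀ − (2/3)(div u) I]`, componentwise. -/
def stress (μ : ℝ) (u : SpaceTime → Fin 3 → ℝ) (q : SpaceTime) (i j : Fin 3) : ℝ :=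
  μ * (pd j (fun q => u q i) q + pd i (fun q => u q j) q
    - (2 / 3) * sdiv u q * (if i = j then (1 : ℝ) else 0))

/-- Product rule for the directional derivative of a product of real functions. -/
theorem fderiv_mul_apply_real {V : Type*} [NormedAddCommGroup V] [NormedSpace ℝ V]
    {f g : V → ℝ} {q : V} (hf : DifferentiableAt ℝ f q) (hg : DifferentiableAt ℝ g q) (v : V) :
    fderiv ℝ (fun q => f q * g q) q v = fderiv ℝ f q v * g q + f q * fderiv ℝ g q v := by
  rw [fderiv_fun_mul hf hg]
  simp
  ring

/-- The directional derivative of the spatial distance to the origin. -/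
theorem fderiv_norm_snd_apply {q : SpaceTime} (hq : q.2 ≠ 0) (v : SpaceTime) :
    fderiv ℝ (fun q : SpaceTime => ‖q.2‖) q v = inner ℝ q.2 v.2 / ‖q.2‖ := by
  have hd : DifferentiableAt ℝ (fun q : SpaceTime => ‖q.2‖) q :=
    differentiableAt_snd.norm ℝ hq
  have hsq : fderiv ℝ (fun q : SpaceTime => ‖q.2‖ * ‖q.2‖) q v = 2 * inner ℝ q.2 v.2 := by
    have h : (fun q : SpaceTime => ‖q.2‖ * ‖q.2‖) = fun q : SpaceTime => inner ℝ q.2 q.2 := by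
      funext q
      rw [real_inner_self_eq_norm_mul_norm]
    rw [h, fderiv_inner_apply ℝ differentiableAt_snd differentiableAt_snd, fderiv_snd]
    simp only [ContinuousLinearMap.coe_snd']
    rw [real_inner_comm q.2 v.2]
    ring
  rw [fderiv_mul_apply_real hd hd] at hsq
  rw [eq_div_iff (norm_ne_zero_iff.mpr hq)]
  linarith

/-- A directional derivative of a `C²` function on an open set is differentiable there. -/
theorem differentiableAt_fderiv_apply_of_contDiffAt {V : Type*} [NormedAddCommGroup V]
    [NormedSpace ℝ V] {f : V → ℝ} {q : V} (hf : ContDiffAt ℝ 2 f q) (v : V) :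
    DifferentiableAt ℝ (fun q => fderiv ℝ f q v) q :=
  ((hf.fderiv_right (m := 1) (by norm_num)).differentiableAt (by norm_num)).clm_apply
    (differentiableAt_const v)

/-- The viscous stress tensor is symmetric. -/
theorem stress_symm (μ : ℝ) (u : SpaceTime → Fin 3 → ℝ) (q : SpaceTime) (i j : Fin 3) :
    stress μ u q i j = stress μ u q j i := by
  simp only [stress, eq_comm (a := i) (b := j)]
  ring

/-- The viscous stress of a `C²` velocity field is differentiable. -/
theorem differentiableAt_stress (μ : ℝ) {u : SpaceTime → Fin 3 → ℝ} {q : SpaceTime}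
    (hu : ∀ i, ContDiffAt ℝ 2 (fun q => u q i) q) (i j : Fin 3) :
    DifferentiableAt ℝ (fun q => stress μ u q i j) q := by
  have h : ∀ k l, DifferentiableAt ℝ (fun q => pd k (fun q => u q l) q) q := fun k l =>
    differentiableAt_fderiv_apply_of_contDiffAt (hu l) _
  have hdiv : DifferentiableAt ℝ (fun q => sdiv u q) q :=
    DifferentiableAt.fun_sum fun k _ => h k k
  unfold stress
  exact (((h j i).fun_add (h i j)).fun_sub ((hdiv.const_mul _).mul_const _)).const_mul μ

/-- Directional derivative of the total energy, cleared of the factor `1 / (γ - 1)`. -/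
theorem fderiv_totalEnergy_apply {γ piInf g₀ : ℝ} (hγ : γ - 1 ≠ 0)
    {p ρ : SpaceTime → ℝ} {u : SpaceTime → Fin 3 → ℝ} {E : SpaceTime → ℝ} {q : SpaceTime}
    (hq : q.2 ≠ 0) (hp : DifferentiableAt ℝ p q) (hρ : DifferentiableAt ℝ ρ q)
    (hu : ∀ i, DifferentiableAt ℝ (fun q => u q i) q)
    (hE : ∀ q : SpaceTime,
      E q = p q / (γ - 1) + γ * piInf / (γ - 1)
        + (1 / 2) * ρ q * (∑ i, (u q i) ^ 2) + ρ q * g₀ * ‖q.2‖) :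
    DifferentiableAt ℝ E q ∧ ∀ v, (γ - 1) * fderiv ℝ E q v = fderiv ℝ p q v + (γ - 1) *
      (fderiv ℝ ρ q v * ((1 / 2) * (∑ i, (u q i) ^ 2) + g₀ * ‖q.2‖)
        + ρ q * ((∑ i, u q i * fderiv ℝ (fun q => u q i) q v)
          + g₀ * (inner ℝ q.2 v.2 / ‖q.2‖))) := by
  have hn : DifferentiableAt ℝ (fun q : SpaceTime => ‖q.2‖) q :=
    differentiableAt_snd.norm ℝ hq
  have hsq : HasFDerivAt (fun q => ∑ i, u q i * u q i)
      (∑ i, (u q i • fderiv ℝ (fun q => u q i) q + u q i • fderiv ℝ (fun q => u q i) q)) q :=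
    HasFDerivAt.fun_sum fun i _ => (hu i).hasFDerivAt.mul (hu i).hasFDerivAt
  have hEq : E = fun q => p q * (γ - 1)⁻¹ + γ * piInf / (γ - 1)
      + ρ q * ((∑ i, u q i * u q i) * (1 / 2) + ‖q.2‖ * g₀) := by
    funext q
    rw [hE]
    simp only [pow_two]
    ring
  have hd := ((hp.hasFDerivAt.mul_const (γ - 1)⁻¹).add_const (γ * piInf / (γ - 1))).add
    (hρ.hasFDerivAt.mul ((hsq.mul_const (1 / 2)).add (hn.hasFDerivAt.mul_const g₀)))
  replace hd := hd.congr_of_eventuallyEq (f₁ := E) (Filter.Eventually.of_forall fun q => by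
    rw [hEq]; rfl)
  refine ⟨hd.differentiableAt, fun v => ?_⟩
  rw [hd.fderiv]
  simp only [add_apply, smul_apply, Pi.add_apply, smul_eq_mul, Fin.sum_univ_three,
    fderiv_norm_snd_apply hq]
  field_simp
  ring

/-- **Derivation of the non-conservative pressure equation from energy conservation.**
With the Stiffened Gas density `ρ = (p + π∞)/(c_V(γ−1)T)`, gravity `g(x) = g₀ x/‖x‖`,
total energy `E = p/(γ−1) + γπ∞/(γ−1) + (1/2)ρ‖u‖² + ρ g₀ ‖x‖`, if mass conservation,
the non-conservative momentum equation, and the conservative energy equation hold on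
`ℝ × Ω`, then the non-conservative pressure equation
`∂ₜp + u·∇p + γ(p + π∞) div u − (γ−1) div(κ∇T) − (γ−1)(∇u : σ̂) = 0` holds on `ℝ × Ω`. -/
theorem pressure_equation_from_energy_conservation
    (Ω : Set (EuclideanSpace ℝ (Fin 3))) (hΩ : IsOpen Ω) (hΩ0 : ∀ x ∈ Ω, x ≠ 0)
    (γ cV piInf μ κ g₀ : ℝ) (hγ : 1 < γ) (hcV : 0 < cV) (ω : Fin 3 → ℝ)
    (p T : SpaceTime → ℝ) (u : SpaceTime → Fin 3 → ℝ) (ρ E : SpaceTime → ℝ)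
    (hp : ContDiffOn ℝ 2 p (Set.univ ×ˢ Ω))
    (hT : ContDiffOn ℝ 2 T (Set.univ ×ˢ Ω))
    (hu : ContDiffOn ℝ 2 u (Set.univ ×ˢ Ω))
    (hppos : ∀ q ∈ Set.univ ×ˢ Ω, 0 < p q + piInf)
    (hTpos : ∀ q ∈ Set.univ ×ˢ Ω, 0 < T q)
    (hρdef : ∀ q : SpaceTime, ρ q = (p q + piInf) / (cV * (γ - 1) * T q))
    (hEdef : ∀ q : SpaceTime,
      E q = p q / (γ - 1) + γ * piInf / (γ - 1)
        + (1 / 2) * ρ q * (∑ i, (u q i) ^ 2) + ρ q * g₀ * ‖q.2‖)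
    (hmass : ∀ q ∈ Set.univ ×ˢ Ω,
      pdt ρ q + sdiv (fun q i => ρ q * u q i) q = 0)
    (hmom : ∀ q ∈ Set.univ ×ˢ Ω, ∀ i,
      pdt (fun q => u q i) q
        + (∑ j, u q j * pd j (fun q => u q i) q)
        + (1 / ρ q) * pd i p q
        - (1 / ρ q) * (∑ j, pd j (fun q => stress μ u q i j) q)
        + g₀ * q.2 i / ‖q.2‖ + 2 * cross ω (u q) i = 0)
    (hener : ∀ q ∈ Set.univ ×ˢ Ω,
      pdt E q + sdiv (fun q j => (E q + p q) * u q j) q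
        - sdiv (fun q j => κ * pd j T q + ∑ i, stress μ u q j i * u q i) q = 0) :
    ∀ q ∈ Set.univ ×ˢ Ω,
      pdt p q + (∑ i, u q i * pd i p q) + γ * (p q + piInf) * sdiv u q
        - (γ - 1) * (∑ j, pd j (fun q => κ * pd j T q) q)
        - (γ - 1) * (∑ i, ∑ j, pd j (fun q => u q i) q * stress μ u q i j) = 0 := by
  intro q hq
  have hq0 : q.2 ≠ 0 := hΩ0 _ hq.2
  have hnhds : Set.univ ×ˢ Ω ∈ nhds q := (isOpen_univ.prod hΩ).mem_nhds hq
  have hγ' : γ - 1 ≠ 0 := (sub_pos.mpr hγ).ne'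
  have hp2 := hp.contDiffAt hnhds
  have hT2 := hT.contDiffAt hnhds
  have hu2 : ∀ i, ContDiffAt ℝ 2 (fun q => u q i) q := contDiffAt_pi.mp (hu.contDiffAt hnhds)
  have hpd : DifferentiableAt ℝ p q := hp2.differentiableAt (by norm_num)
  have hTd : DifferentiableAt ℝ T q := hT2.differentiableAt (by norm_num)
  have hud : ∀ i, DifferentiableAt ℝ (fun q => u q i) q := fun i =>
    (hu2 i).differentiableAt (by norm_num)
  have hden : cV * (γ - 1) * T q ≠ 0 :=
    mul_ne_zero (mul_ne_zero hcV.ne' hγ') (hTpos q hq).ne'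
  have hρ0 : ρ q ≠ 0 := by
    rw [hρdef]
    exact div_ne_zero (hppos q hq).ne' hden
  have hρd : DifferentiableAt ℝ ρ q := by
    rw [show ρ = fun q => (p q + piInf) / (cV * (γ - 1) * T q) from funext hρdef]
    fun_prop (disch := exact hden)
  obtain ⟨hEd, hE⟩ := fderiv_totalEnergy_apply hγ' hq0 hpd hρd hud hEdef
  have hE0 : (γ - 1) * E q = p q + γ * piInf
      + (γ - 1) * (ρ q * ((1 / 2) * (∑ i, (u q i) ^ 2) + g₀ * ‖q.2‖)) := by
    rw [hEdef]
    field_simp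
    ring
  have hEt := hE (1, 0)
  have hEs := fun i : Fin 3 => hE (0, EuclideanSpace.single i 1)
  simp only [inner_zero_right, EuclideanSpace.inner_single_right, one_mul, conj_trivial] at hEt hEs
  have hmass_q : pdt ρ q + ∑ i, (pd i ρ q * u q i + ρ q * pd i (fun q => u q i) q) = 0 := by
    rw [← hmass q hq]
    simp only [sdiv, pd, fderiv_mul_apply_real hρd (hud _)]
  have hflux : sdiv (fun q j => (E q + p q) * u q j) q
      = ∑ j, ((pd j E q + pd j p q) * u q j + (E q + p q) * pd j (fun q => u q j) q) := by
    simp only [sdiv, pd, fderiv_mul_apply_real (hEd.fun_add hpd) (hud _), fderiv_fun_add hEd hpd,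
      add_apply]
  have hσd := differentiableAt_stress μ hu2
  have hκd : ∀ j, DifferentiableAt ℝ (fun q => κ * pd j T q) q := fun j =>
    (differentiableAt_fderiv_apply_of_contDiffAt hT2 _).const_mul κ
  have hvisc : sdiv (fun q j => κ * pd j T q + ∑ i, stress μ u q j i * u q i) q
      = ∑ j, (pd j (fun q => κ * pd j T q) q
        + ∑ i, (pd j (fun q => stress μ u q i j) q * u q i
          + stress μ u q i j * pd j (fun q => u q i) q)) := by
    unfold sdiv
    refine Finset.sum_congr rfl fun j _ => ?_
    have hσu : ∀ i, DifferentiableAt ℝ (fun q => stress μ u q i j * u q i) q := fun i =>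
      (hσd i j).fun_mul (hud i)
    simp only [stress_symm μ u _ j]
    rw [pd, fderiv_fun_add (hκd j) (DifferentiableAt.fun_sum fun i _ => hσu i),
      fderiv_fun_sum fun i _ => hσu i]
    simp only [add_apply, sum_apply, fderiv_mul_apply_real (hσd _ j) (hud _), pd]
  have hmom_q : ∀ i, ρ q * (pdt (fun q => u q i) q + (∑ j, u q j * pd j (fun q => u q i) q)
        + g₀ * q.2 i / ‖q.2‖ + 2 * cross ω (u q) i) + pd i p q
        - (∑ j, pd j (fun q => stress μ u q i j) q) = 0 := by
    intro i
    have h := congrArg (ρ q * ·) (hmom q hq i)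
    simp only [mul_zero] at h
    rw [← h]
    field_simp
    ring
  have hen := hener q hq
  rw [hflux, hvisc] at hen
  have hm0 := hmom_q 0
  have hm1 := hmom_q 1
  have hm2 := hmom_q 2
  have hE1 := hEs 0
  have hE2 := hEs 1
  have hE3 := hEs 2
  change (γ - 1) * pdt E q
    = pdt p q + (γ - 1) * (pdt ρ q * _ + ρ q * ((∑ i, u q i * pdt (fun q => u q i) q) + _)) at hEt
  change (γ - 1) * pd _ E q
    = pd _ p q + (γ - 1) * (pd _ ρ q * _ + ρ q * ((∑ i, u q i * pd _ (fun q => u q i) q) + _))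
    at hE1 hE2 hE3
  simp only [sdiv, cross, Fin.sum_univ_three, Matrix.cons_val] at *
  linear_combination (γ - 1) * hen - hEt - u q 0 * hE1 - u q 1 * hE2 - u q 2 * hE3
    - (pd 0 (fun q => u q 0) q + pd 1 (fun q => u q 1) q + pd 2 (fun q => u q 2) q) * hE0
    - (γ - 1) * ((1 / 2) * (u q 0 ^ 2 + u q 1 ^ 2 + u q 2 ^ 2) + g₀ * ‖q.2‖) * hmass_q
    - (γ - 1) * (u q 0 * hm0 + u q 1 * hm1 + u q 2 * hm2)

end
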